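/- Let d be an admissible sequence and, for each integer l with |l| < l₁, let e_l be an l-stabilized family. Then for every real s > 0 the series F₂(s) = Σ_{l=-l₁+1}^{l₁-1} α^l Σ_{n∈ℤ} Σ_{m≥0} q^{-m} d_m e_l(n,m) (q^{s(|n+m+l|+|n+l|)} - q^{s(|n+m|+|n|)}) converges absolutely, and lim_{s→0⁺} s·F₂(s) = 0. -/

import Mathlib

open Filter Topology

noncomputable section

/-- `qc q x` is the real power `q ^ x`, viewed as a complex number. -/
def qc (q : ℝ) (x : ℝ) : ℂ := ((q ^ x : ℝ) : ℂ)

/-- An admissible sequence: `d m = q^(m/2) (c₁ c^m + c₂ c^(-m))` for all `m ≥ l₁`. -/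
def IsAdmissibleSeq (q : ℝ) (c : ℂ) (l₁ : ℤ) (d : ℕ → ℂ) : Prop :=
  ∃ c₁ c₂ : ℂ, ∀ m : ℕ, l₁ ≤ (m : ℤ) →
    d m = qc q ((m : ℝ) / 2) * (c₁ * c ^ (m : ℤ) + c₂ * c ^ (-(m : ℤ)))

/-- An admissible family on `ℤ × ℕ`, given by region asymptotics. -/
def IsAdmissibleFam (q : ℝ) (l₁ : ℤ) (a : ℤ → ℕ → ℂ) : Prop :=
  ∃ (k₁ k₂ k₃ : ℂ) (A B : ℤ → ℂ), ∀ (n : ℤ) (m : ℕ),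
    (l₁ ≤ n → a n m = k₁) ∧
    (-l₁ < n → n < l₁ → l₁ ≤ n + (m : ℤ) → a n m = A n) ∧
    (n ≤ -l₁ → l₁ ≤ n + (m : ℤ) → a n m = qc q (-(n : ℝ)) * k₂) ∧
    (n ≤ -l₁ → -l₁ < n + (m : ℤ) → n + (m : ℤ) < l₁ →
      a n m = qc q (-(n : ℝ)) * B (n + m)) ∧
    (n + (m : ℤ) ≤ -l₁ → a n m = qc q (-(2 * (n : ℝ) + (m : ℝ))) * k₃)

/-- An `l`-stabilized family on `ℤ × ℕ` (the regions do not depend on `l`). -/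
def IsStabilizedFam (q : ℝ) (c : ℂ) (l₁ : ℤ) (e : ℤ → ℕ → ℂ) : Prop :=
  ∃ (u w : ℂ) (f v : ℤ → ℂ) (N : ℤ), 2 * l₁ < N ∧ ∀ (n : ℤ) (m : ℕ),
    (l₁ ≤ n → e n m = (c ^ 2 * (q : ℂ)) ^ n * (c * qc q (1 / 2)) ^ m * u) ∧
    (-l₁ < n → n < l₁ → N ≤ (m : ℤ) → e n m = (c * qc q (1 / 2)) ^ m * f n) ∧
    (n ≤ -l₁ → -l₁ < n + (m : ℤ) → n + (m : ℤ) < l₁ → N ≤ (m : ℤ) →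
      e n m = qc q ((m : ℝ) / 2) * c ^ (-(m : ℤ)) * v (n + m)) ∧
    (n + (m : ℤ) ≤ -l₁ → e n m = (c ^ 2 * (q : ℂ)⁻¹) ^ n * (c * qc q (-(1 / 2))) ^ m * w)

lemma exists_bound_of_finset_compl {ι : Type*} (F : Finset ι) (f g : ι → ℝ) (P : ι → Prop)
    (hf : ∀ i, 0 ≤ f i) (hg : ∀ i, 0 < g i) (C : ℝ)
    (h : ∀ i, P i → i ∉ F → f i ≤ C * g i) :
    ∃ K, 0 ≤ K ∧ ∀ i, P i → f i ≤ K * g i := by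
  have hsum : 0 ≤ ∑ j ∈ F, f j / g j :=
    Finset.sum_nonneg fun j _ => div_nonneg (hf j) (hg j).le
  refine ⟨|C| + ∑ j ∈ F, f j / g j, by positivity, fun i hi => ?_⟩
  by_cases hiF : i ∈ F
  · have h1 : f i / g i ≤ ∑ j ∈ F, f j / g j :=
      Finset.single_le_sum (f := fun j => f j / g j)
        (fun j _ => div_nonneg (hf j) (hg j).le) hiF
    rw [← div_le_iff₀ (hg i)]
    linarith [abs_nonneg C]
  · refine (h i hi hiF).trans (mul_le_mul_of_nonneg_right ?_ (hg i).le)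
    linarith [le_abs_self C]

lemma norm_qc {q : ℝ} (hq0 : 0 < q) (x : ℝ) : ‖qc q x‖ = q ^ x := by
  rw [qc, Complex.norm_real, Real.norm_of_nonneg (Real.rpow_nonneg hq0.le x)]

/-- The weight `q^|n| + q^|n+m|`, which dominates the coefficients of the series. -/
def stabWeight (q : ℝ) (p : ℤ × ℕ) : ℝ :=
  q ^ |(p.1 : ℝ)| + q ^ |(p.1 : ℝ) + (p.2 : ℝ)|

lemma stabWeight_pos {q : ℝ} (hq0 : 0 < q) (p : ℤ × ℕ) : 0 < stabWeight q p := by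
  unfold stabWeight
  positivity

lemma IsAdmissibleSeq.exists_bound {q : ℝ} (hq0 : 0 < q) {c : ℂ} (hc : ‖c‖ = 1) {l₁ : ℤ}
    {d : ℕ → ℂ} (hd : IsAdmissibleSeq q c l₁ d) :
    ∃ D, 0 ≤ D ∧ ∀ m, ‖d m‖ ≤ D * q ^ ((m : ℝ) / 2) := by
  obtain ⟨c₁, c₂, h⟩ := hd
  obtain ⟨K, hK, hb⟩ := exists_bound_of_finset_compl (Finset.range l₁.toNat)
    (fun m => ‖d m‖) (fun m : ℕ => q ^ ((m : ℝ) / 2)) (fun _ => True)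
    (fun _ => norm_nonneg _) (fun _ => Real.rpow_pos_of_pos hq0 _) (‖c₁‖ + ‖c₂‖) (by
      intro m _ hm
      have hm' : l₁ ≤ (m : ℤ) := by
        rw [Finset.mem_range] at hm
        omega
      have h1 : ‖c₁ * c ^ (m : ℤ) + c₂ * c ^ (-(m : ℤ))‖ ≤ ‖c₁‖ + ‖c₂‖ := by
        refine (norm_add_le _ _).trans_eq ?_
        simp only [norm_mul, norm_zpow, hc, one_zpow, mul_one]
      rw [h m hm', norm_mul, norm_qc hq0, mul_comm]
      exact mul_le_mul_of_nonneg_right h1 (Real.rpow_nonneg hq0.le _))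
  exact ⟨K, hK, fun m => hb m trivial⟩

lemma IsStabilizedFam.exists_bound {q : ℝ} (hq0 : 0 < q) (hq1 : q < 1) {c : ℂ} (hc : ‖c‖ = 1)
    {l₁ : ℤ} {e : ℤ → ℕ → ℂ} (he : IsStabilizedFam q c l₁ e) :
    ∃ E, 0 ≤ E ∧ ∀ p : ℤ × ℕ, ¬ (p.1 ≤ -l₁ ∧ l₁ ≤ p.1 + (p.2 : ℤ)) →
      ‖e p.1 p.2‖ ≤ E * (q ^ ((p.2 : ℝ) / 2) * stabWeight q p) := by
  obtain ⟨u, w, f, v, N, -, h⟩ := he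
  set S : ℝ := ∑ k ∈ Finset.Ioo (-l₁) l₁, (‖f k‖ + ‖v k‖) with hS
  have hS0 : 0 ≤ S := Finset.sum_nonneg fun k _ => by positivity
  have hfv : ∀ k ∈ Finset.Ioo (-l₁) l₁, ‖f k‖ + ‖v k‖ ≤ S := fun k hk =>
    Finset.single_le_sum (f := fun k => ‖f k‖ + ‖v k‖) (fun k _ => by positivity) hk
  set E : ℝ := ‖u‖ + ‖w‖ + S * q ^ (-(l₁ : ℝ)) with hE
  have hP : 0 < q ^ (-(l₁ : ℝ)) := Real.rpow_pos_of_pos hq0 _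
  have hSP : 0 ≤ S * q ^ (-(l₁ : ℝ)) := by positivity
  have hSE : ∀ k ∈ Finset.Ioo (-l₁) l₁, S ≤ E * q ^ |(k : ℝ)| := by
    intro k hk
    rw [Finset.mem_Ioo] at hk
    have h1 : |(k : ℝ)| ≤ l₁ := by
      rw [abs_le]
      constructor
      · exact_mod_cast hk.1.le
      · exact_mod_cast hk.2.le
    have h2 : q ^ (l₁ : ℝ) ≤ q ^ |(k : ℝ)| :=
      Real.rpow_le_rpow_of_exponent_ge hq0 hq1.le h1
    calc S = S * q ^ (-(l₁ : ℝ)) * q ^ (l₁ : ℝ) := by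
            rw [mul_assoc, ← Real.rpow_add hq0]; simp
      _ ≤ E * q ^ |(k : ℝ)| := by
            have h3 : 0 < q ^ (l₁ : ℝ) := Real.rpow_pos_of_pos hq0 _
            apply mul_le_mul _ h2 h3.le (by positivity)
            linarith [norm_nonneg u, norm_nonneg w]
  have hE0 : 0 ≤ E := by positivity
  refine exists_bound_of_finset_compl
    (Finset.Icc (-(l₁ + N)) l₁ ×ˢ Finset.range N.toNat)
    (fun p : ℤ × ℕ => ‖e p.1 p.2‖) (fun p => q ^ ((p.2 : ℝ) / 2) * stabWeight q p)
    (fun p => ¬ (p.1 ≤ -l₁ ∧ l₁ ≤ p.1 + (p.2 : ℤ))) (fun _ => norm_nonneg _)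
    (fun p => mul_pos (Real.rpow_pos_of_pos hq0 _) (stabWeight_pos hq0 p)) E ?_
  rintro ⟨n, m⟩ hV hF
  obtain ⟨hI, hII, hIII, hIV⟩ := h n m
  simp only [Finset.mem_product, Finset.mem_Icc, Finset.mem_range] at hF hV ⊢
  have hA : 0 < q ^ |(n : ℝ)| := Real.rpow_pos_of_pos hq0 _
  have hB : 0 < q ^ |(n : ℝ) + (m : ℝ)| := Real.rpow_pos_of_pos hq0 _
  have hM : 0 < q ^ ((m : ℝ) / 2) := Real.rpow_pos_of_pos hq0 _
  -- it suffices to bound by one of the two summands of the weight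
  have key : ∀ X : ℝ, (X ≤ E * q ^ |(n : ℝ)| ∨ X ≤ E * q ^ |(n : ℝ) + (m : ℝ)|) →
      ‖e n m‖ = q ^ ((m : ℝ) / 2) * X →
      ‖e n m‖ ≤ E * (q ^ ((m : ℝ) / 2) * stabWeight q (n, m)) := by
    intro X hX heX
    have hX' : X ≤ E * stabWeight q (n, m) := by
      unfold stabWeight
      have := mul_nonneg hE0 hA.le
      have := mul_nonneg hE0 hB.le
      rcases hX with hX | hX <;> simp only [mul_add] <;> linarith
    rw [heX]
    calc _ ≤ q ^ ((m : ℝ) / 2) * (E * stabWeight q (n, m)) :=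
            mul_le_mul_of_nonneg_left hX' hM.le
      _ = _ := by ring
  have hpow : ∀ x : ℝ, (q ^ x) ^ m = q ^ (x * m) := fun x => by
    rw [← Real.rpow_natCast, ← Real.rpow_mul hq0.le]
  rcases le_or_gt l₁ n with h1 | h1
  · refine key (q ^ (n : ℝ) * ‖u‖) (Or.inl ?_) ?_
    · rcases le_or_gt 0 n with h0 | h0
      · rw [abs_of_nonneg (by exact_mod_cast h0), mul_comm]
        exact mul_le_mul_of_nonneg_right (by linarith [norm_nonneg w])
          (Real.rpow_nonneg hq0.le _)
      · exfalso
        omega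
    · rw [hI h1]
      simp only [norm_mul, norm_zpow, norm_pow, hc, norm_qc hq0, one_pow, one_mul,
        Complex.norm_real, Real.norm_of_nonneg hq0.le, hpow]
      rw [Real.rpow_intCast, show (1 / 2 : ℝ) * m = m / 2 by ring]
      ring
  rcases lt_or_ge (-l₁) n with h2 | h2
  · refine key ‖f n‖ (Or.inl ?_) ?_
    · have hn : n ∈ Finset.Ioo (-l₁) l₁ := Finset.mem_Ioo.2 ⟨h2, h1⟩
      linarith [hfv n hn, hSE n hn, norm_nonneg (v n)]
    · rw [hII h2 h1 (by omega)]
      simp only [norm_mul, norm_pow, hc, norm_qc hq0, one_mul, hpow]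
      rw [show (1 / 2 : ℝ) * m = m / 2 by ring]
  rcases lt_or_ge (-l₁) (n + m) with h3 | h3
  · refine key ‖v (n + m)‖ (Or.inr ?_) ?_
    · have hn : n + (m : ℤ) ∈ Finset.Ioo (-l₁) l₁ := Finset.mem_Ioo.2 ⟨h3, by omega⟩
      have := hSE _ hn
      push_cast at this
      linarith [hfv _ hn, norm_nonneg (f (n + m))]
    · rw [hIII h2 h3 (by omega) (by omega)]
      simp only [norm_mul, norm_zpow, hc, norm_qc hq0, one_zpow, mul_one]
  · refine key (q ^ (-((n : ℝ) + m)) * ‖w‖) (Or.inr ?_) ?_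
    · have h0 : (n : ℝ) + m ≤ 0 := by
        have : n + (m : ℤ) ≤ 0 := by omega
        exact_mod_cast this
      rw [abs_of_nonpos h0, mul_comm]
      exact mul_le_mul_of_nonneg_right (by linarith [norm_nonneg u])
        (Real.rpow_nonneg hq0.le _)
    · rw [hIV h3]
      simp only [norm_mul, norm_zpow, norm_pow, norm_inv, hc, norm_qc hq0, one_pow, one_mul,
        Complex.norm_real, Real.norm_of_nonneg hq0.le, hpow]
      rw [inv_zpow, ← zpow_neg, ← Real.rpow_intCast, ← mul_assoc, ← Real.rpow_add hq0,
        ← Real.rpow_add hq0]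
      congr 2
      push_cast
      ring

lemma abs_rpow_mul_sub_rpow_mul_le {q : ℝ} (hq0 : 0 < q) (hq1 : q < 1) {s : ℝ} (hs : 0 < s)
    {x y m K : ℝ} (hx : m ≤ x) (hy : m ≤ y) (hxy : |x - y| ≤ K) :
    |q ^ (s * x) - q ^ (s * y)| ≤ K * -Real.log q * s * q ^ (s * m) := by
  have hlog : Real.log q < 0 := Real.log_neg hq0 hq1
  wlog hle : x ≤ y generalizing x y
  · rw [abs_sub_comm]
    exact this hy hx (by rwa [abs_sub_comm]) (by linarith)
  have h1 : q ^ (s * y) ≤ q ^ (s * x) :=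
    Real.rpow_le_rpow_of_exponent_ge hq0 hq1.le (by gcongr)
  have h2 : q ^ (s * x) ≤ q ^ (s * m) :=
    Real.rpow_le_rpow_of_exponent_ge hq0 hq1.le (by gcongr)
  have h3 : q ^ (s * y) = q ^ (s * x) * q ^ (s * (y - x)) := by
    rw [← Real.rpow_add hq0]
    ring_nf
  have h4 : 1 + Real.log q * (s * (y - x)) ≤ q ^ (s * (y - x)) := by
    rw [Real.rpow_def_of_pos hq0]
    linarith [Real.add_one_le_exp (Real.log q * (s * (y - x)))]
  have h5 : y - x ≤ K := by
    rw [abs_sub_comm] at hxy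
    exact (le_abs_self _).trans hxy
  have hX : 0 < q ^ (s * x) := Real.rpow_pos_of_pos hq0 _
  rw [abs_of_nonneg (by linarith), h3]
  calc q ^ (s * x) - q ^ (s * x) * q ^ (s * (y - x))
      = (1 - q ^ (s * (y - x))) * q ^ (s * x) := by ring
    _ ≤ (K * -Real.log q * s) * q ^ (s * x) := by
        refine mul_le_mul_of_nonneg_right ?_ hX.le
        have : -Real.log q * s * (y - x) ≤ -Real.log q * s * K :=
          mul_le_mul_of_nonneg_left h5 (mul_nonneg (by linarith) hs.le)
        linarith
    _ ≤ _ := by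
        refine mul_le_mul_of_nonneg_left h2 ?_
        exact mul_nonneg (mul_nonneg (by linarith) (by linarith)) hs.le

lemma summable_rpow_abs_int {q : ℝ} (hq0 : 0 < q) (hq1 : q < 1) :
    Summable fun n : ℤ => q ^ |(n : ℝ)| := by
  have h := summable_geometric_of_lt_one hq0.le hq1
  refine Summable.of_nat_of_neg (h.congr fun n => ?_) (h.congr fun n => ?_) <;> simp

/-- Summation of the weight against a geometric factor in the second variable. -/
lemma hasSum_stabWeight_mul_pow {q : ℝ} (hq0 : 0 < q) (hq1 : q < 1) {r : ℝ} (hr0 : 0 ≤ r)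
    (hr1 : r < 1) :
    HasSum (fun p : ℤ × ℕ => stabWeight q p * r ^ p.2)
      (2 * (∑' n : ℤ, q ^ |(n : ℝ)|) * (1 - r)⁻¹) := by
  have h1 : HasSum (fun p : ℤ × ℕ => q ^ |(p.1 : ℝ)| * r ^ p.2)
      ((∑' n : ℤ, q ^ |(n : ℝ)|) * (1 - r)⁻¹) := by
    refine (summable_rpow_abs_int hq0 hq1).hasSum.mul (hasSum_geometric_of_lt_one hr0 hr1) ?_
    exact (summable_rpow_abs_int hq0 hq1).mul_of_nonneg
      (summable_geometric_of_lt_one hr0 hr1) (fun _ => Real.rpow_nonneg hq0.le _)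
      (fun _ => pow_nonneg hr0 _)
  let φ : ℤ × ℕ ≃ ℤ × ℕ :=
    { toFun := fun p => (p.1 + p.2, p.2)
      invFun := fun p => (p.1 - p.2, p.2)
      left_inv := fun p => by simp
      right_inv := fun p => by simp }
  have h2 := (φ.hasSum_iff).2 h1
  convert h1.add h2 using 1
  · ext p
    simp [φ, stabWeight, add_mul]
  · ring

/-- claim (2) in the proof of Lemma 5.1. -/
theorem stmt2 (q : ℝ) (hq0 : 0 < q) (hq1 : q < 1) (c α : ℂ)
    (hc : ‖c‖ = 1) (hα : ‖α‖ = 1) (l₁ : ℤ) (hl₁ : 0 < l₁)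
    (d : ℕ → ℂ) (hd : IsAdmissibleSeq q c l₁ d)
    (e : ℤ → ℤ → ℕ → ℂ) (he : ∀ l : ℤ, |l| < l₁ → IsStabilizedFam q c l₁ (e l))
    (T : ℝ → ℤ → ℤ × ℕ → ℂ)
    (hT : ∀ (s : ℝ) (l : ℤ) (n : ℤ) (m : ℕ),
      T s l (n, m) = qc q (-(m : ℝ)) * d m * e l n m *
        (qc q (s * (((|n + (m : ℤ) + l| : ℤ) : ℝ) + ((|n + l| : ℤ) : ℝ))) -
         qc q (s * (((|n + (m : ℤ)| : ℤ) : ℝ) + ((|n| : ℤ) : ℝ))))) :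
    (∀ s : ℝ, 0 < s → ∀ l ∈ Finset.Ioo (-l₁) l₁,
      Summable fun p : ℤ × ℕ => ‖T s l p‖) ∧
    Tendsto (fun s : ℝ => (s : ℂ) *
        ∑ l ∈ Finset.Ioo (-l₁) l₁, α ^ l * ∑' p : ℤ × ℕ, T s l p)
      (𝓝[>] (0 : ℝ)) (𝓝 0) := by
  have hterm : ∀ l ∈ Finset.Ioo (-l₁) l₁, ∃ K, 0 ≤ K ∧ ∀ s : ℝ, 0 < s → ∀ p : ℤ × ℕ,
      ‖T s l p‖ ≤ K * s * (stabWeight q p * (q ^ s) ^ p.2) := by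
    intro l hl
    have hl' : |l| < l₁ := abs_lt.2 (Finset.mem_Ioo.1 hl)
    obtain ⟨D, hD0, hD⟩ := hd.exists_bound hq0 hc
    obtain ⟨E, hE0, hE⟩ := (he l hl').exists_bound hq0 hq1 hc
    have hlog : 0 < -Real.log q := neg_pos.2 (Real.log_neg hq0 hq1)
    have hl₁' : (0 : ℝ) < l₁ := by exact_mod_cast hl₁
    refine ⟨D * E * (2 * l₁ * -Real.log q), by positivity, ?_⟩
    rintro s hs ⟨n, m⟩
    have hw := stabWeight_pos hq0 (n, m)
    rw [hT]
    by_cases hV : n ≤ -l₁ ∧ l₁ ≤ n + (m : ℤ)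
    · have hxy : |n + (m : ℤ) + l| + |n + l| = |n + (m : ℤ)| + |n| := by
        rw [abs_lt] at hl'
        rw [abs_of_nonneg (by omega), abs_of_nonpos (by omega), abs_of_nonneg (by omega),
          abs_of_nonpos (by omega)]
        ring
      rw [← Int.cast_add, ← Int.cast_add, hxy, sub_self, mul_zero, norm_zero]
      positivity
    · have hdiff := abs_rpow_mul_sub_rpow_mul_le hq0 hq1 hs (m := m) (K := 2 * l₁)
        (x := ((|n + (m : ℤ) + l| : ℤ) : ℝ) + ((|n + l| : ℤ) : ℝ))
        (y := ((|n + (m : ℤ)| : ℤ) : ℝ) + ((|n| : ℤ) : ℝ))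
        (by norm_cast; grind) (by norm_cast; grind)
        (by
          rw [abs_lt] at hl'
          norm_cast
          rw [abs_le]
          constructor <;> rcases abs_cases (n + (m : ℤ) + l) with h1 | h1 <;>
            rcases abs_cases (n + l) with h2 | h2 <;>
            rcases abs_cases (n + (m : ℤ)) with h3 | h3 <;>
            rcases abs_cases n with h4 | h4 <;> omega)
      have hcoef : ‖qc q (-(m : ℝ)) * d m * e l n m‖ ≤ D * E * stabWeight q (n, m) := by
        rw [norm_mul, norm_mul, norm_qc hq0]
        have hq : q ^ (-(m : ℝ)) * q ^ ((m : ℝ) / 2) * q ^ ((m : ℝ) / 2) = 1 := by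
          rw [← Real.rpow_add hq0, ← Real.rpow_add hq0]
          ring_nf
          exact Real.rpow_zero q
        calc _ ≤ q ^ (-(m : ℝ)) * (D * q ^ ((m : ℝ) / 2)) *
              (E * (q ^ ((m : ℝ) / 2) * stabWeight q (n, m))) := by
                gcongr
                · exact hD m
                · exact hE (n, m) hV
          _ = q ^ (-(m : ℝ)) * q ^ ((m : ℝ) / 2) * q ^ ((m : ℝ) / 2) *
              (D * E * stabWeight q (n, m)) := by ring
          _ = _ := by rw [hq, one_mul]
      rw [norm_mul, qc.eq_1 q (s * _), qc.eq_1 q (s * _), ← Complex.ofReal_sub,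
        Complex.norm_real, Real.norm_eq_abs]
      refine (mul_le_mul hcoef hdiff (abs_nonneg _) (by positivity)).trans_eq ?_
      rw [← Real.rpow_natCast, ← Real.rpow_mul hq0.le]
      ring
  choose! K hK0 hK using hterm
  have hr1 : ∀ s : ℝ, 0 < s → q ^ s < 1 := fun s hs => Real.rpow_lt_one hq0.le hq1 hs
  have hsum : ∀ s : ℝ, 0 < s → ∀ l : ℤ, HasSum
      (fun p : ℤ × ℕ => K l * s * (stabWeight q p * (q ^ s) ^ p.2))
      (K l * s * (2 * (∑' n : ℤ, q ^ |(n : ℝ)|) * (1 - q ^ s)⁻¹)) := fun s hs l =>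
    (hasSum_stabWeight_mul_pow hq0 hq1 (Real.rpow_nonneg hq0.le s) (hr1 s hs)).mul_left _
  refine ⟨fun s hs l hl => Summable.of_nonneg_of_le (fun _ => norm_nonneg _)
    (hK l hl s hs) (hsum s hs l).summable, ?_⟩
  set G : ℝ := ∑' n : ℤ, q ^ |(n : ℝ)|
  have hG : 0 ≤ G := tsum_nonneg fun n => Real.rpow_nonneg hq0.le _
  have hbound : ∀ s : ℝ, 0 < s → s < 1 → ∀ l ∈ Finset.Ioo (-l₁) l₁,
      ‖α ^ l * ∑' p : ℤ × ℕ, T s l p‖ ≤ K l * (2 * G * (1 - q)⁻¹) := by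
    intro s hs hs1 l hl
    rw [norm_mul, norm_zpow, hα, one_zpow, one_mul]
    refine (tsum_of_norm_bounded (hsum s hs l) (hK l hl s hs)).trans ?_
    have h1 : s * (1 - q) ≤ 1 - q ^ s := by
      have := rpow_one_add_le_one_add_mul_self (s := q - 1) (by linarith) hs.le hs1.le
      rw [add_sub_cancel] at this
      linarith
    have h2 : s * (1 - q ^ s)⁻¹ ≤ (1 - q)⁻¹ := by
      rw [← div_eq_mul_inv, div_le_iff₀ (by linarith [hr1 s hs]), ← div_eq_inv_mul,
        le_div_iff₀ (by linarith)]
      exact h1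
    calc K l * s * (2 * G * (1 - q ^ s)⁻¹) = K l * (2 * G * (s * (1 - q ^ s)⁻¹)) := by ring
      _ ≤ _ := mul_le_mul_of_nonneg_left
        (mul_le_mul_of_nonneg_left h2 (by positivity)) (hK0 l hl)
  refine squeeze_zero_norm' (a := fun s : ℝ =>
    s * ∑ l ∈ Finset.Ioo (-l₁) l₁, K l * (2 * G * (1 - q)⁻¹)) ?_ ?_
  · filter_upwards [Ioo_mem_nhdsGT (zero_lt_one' ℝ)] with s hs
    rw [norm_mul, Complex.norm_real, Real.norm_of_nonneg hs.1.le]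
    exact mul_le_mul_of_nonneg_left
      (norm_sum_le_of_le _ fun l hl => hbound s hs.1 hs.2 l hl) hs.1.le
  · refine tendsto_nhdsWithin_of_tendsto_nhds ?_
    exact (continuous_id.mul continuous_const).tendsto' _ _ (zero_mul _)
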